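/- The (d−1)-skeleton of the (2d)-dimensional simplex does not topologically embed in ℝ^(2d−2) (Van Kampen–Flores theorem). -/

import Mathlib

/-- A finite abstract simplicial complex on vertex set `V`: a downward-closed
family of nonempty finite sets. -/
structure SimplicialCx (V : Type) [DecidableEq V] where
  faces : Finset (Finset V)
  nonempty_of_mem : ∀ σ ∈ faces, σ.Nonempty
  down_closed : ∀ σ ∈ faces, ∀ τ, τ ⊆ σ → τ.Nonempty → τ ∈ faces

variable {V : Type} [DecidableEq V]

/-- An elementary collapse removes a free pair `(σ, σ')`: `σ'` is the unique face
of `C` properly containing `σ`, and `dim σ' = dim σ + 1`. -/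
def IsElementaryCollapse (C C' : SimplicialCx V) : Prop :=
  ∃ σ σ' : Finset V, σ ∈ C.faces ∧ σ' ∈ C.faces ∧ σ ⊂ σ' ∧
    σ'.card = σ.card + 1 ∧ (∀ τ ∈ C.faces, σ ⊂ τ → τ = σ') ∧
    C'.faces = C.faces \ {σ, σ'}

/-- A complex is collapsible if a sequence of elementary collapses reduces it to
a single vertex. -/
def Collapsible (C : SimplicialCx V) : Prop :=
  ∃ C' : SimplicialCx V, Relation.ReflTransGen IsElementaryCollapse C C' ∧
    ∃ v : V, C'.faces = {{v}}

/-- A linear embedding of `C` in `ℝ^m`: vertices go to points such that each face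
spans an affinely independent set, and the geometric simplices of two faces meet
exactly in the geometric simplex of their common face. -/
def LinearlyEmbeds (C : SimplicialCx V) (m : ℕ) : Prop :=
  ∃ f : V → EuclideanSpace ℝ (Fin m),
    (∀ σ ∈ C.faces, AffineIndependent ℝ (fun x : σ => f x)) ∧
    ∀ σ ∈ C.faces, ∀ τ ∈ C.faces,
      convexHull ℝ (f '' ↑σ) ∩ convexHull ℝ (f '' ↑τ)
        = convexHull ℝ (f '' ↑(σ ∩ τ))

/-- The geometric realization of a finite simplicial complex on vertex set `V`,
as a subspace of `V → ℝ`: convex weight functions supported on a face. -/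
def realization {V : Type} [DecidableEq V] [Fintype V] (C : SimplicialCx V) :
    Set (V → ℝ) :=
  {w | ∃ σ ∈ C.faces, (∀ v, 0 ≤ w v) ∧ (∀ v, v ∉ σ → w v = 0) ∧ ∑ v ∈ σ, w v = 1}

/-- A topological embedding of `C` in `ℝ^m`: a topological embedding of the
geometric realization of `C` into `ℝ^m`. -/
def TopologicallyEmbeds {V : Type} [DecidableEq V] [Fintype V]
    (C : SimplicialCx V) (m : ℕ) : Prop :=
  ∃ f : ↥(realization C) → EuclideanSpace ℝ (Fin m), Topology.IsEmbedding f

namespace ListChain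

open Finsupp

variable {α : Type*}

/-- The cone with apex `a`, prepending `a` to each simplex of a mod 2 chain of ordered simplices. -/
noncomputable def cone (a : α) : (List α →₀ ZMod 2) →ₗ[ZMod 2] (List α →₀ ZMod 2) :=
  lmapDomain (ZMod 2) (ZMod 2) (List.cons a)

@[simp] theorem cone_single (a : α) (l : List α) (r : ZMod 2) :
    cone a (single l r) = single (a :: l) r := by
  simp [cone]

/-- The sum of the facets of an ordered simplex. -/
noncomputable def faceSum : List α → (List α →₀ ZMod 2)
  | [] => 0
  | a :: l => single l 1 + cone a (faceSum l)

/-- The mod 2 boundary operator, augmented by the empty simplex. -/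
noncomputable def boundary : (List α →₀ ZMod 2) →ₗ[ZMod 2] (List α →₀ ZMod 2) :=
  linearCombination (ZMod 2) faceSum

@[simp] theorem boundary_single (l : List α) : boundary (single l 1) = faceSum l := by
  simp [boundary]

theorem add_self_eq_zero (c : List α →₀ ZMod 2) : c + c = 0 := by
  ext l
  exact CharTwo.add_self_eq_zero _

theorem boundary_cone (a : α) (c : List α →₀ ZMod 2) :
    boundary (cone a c) = c + cone a (boundary c) := by
  suffices boundary ∘ₗ cone a = LinearMap.id + cone a ∘ₗ boundary from LinearMap.congr_fun this c
  ext1 l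
  ext1
  simp [faceSum]

theorem boundary_faceSum (l : List α) : boundary (faceSum l) = 0 := by
  induction l with
  | nil => simp [faceSum]
  | cons a l ih => simp [faceSum, boundary_cone, ih, add_self_eq_zero]

theorem map_mem_of_mem_supported {M : Type*} [AddCommMonoid M] [Module (ZMod 2) M]
    {A : Set (List α)} {P : Submodule (ZMod 2) M} {L : (List α →₀ ZMod 2) →ₗ[ZMod 2] M}
    (h : ∀ l ∈ A, L (single l 1) ∈ P) {c : List α →₀ ZMod 2}
    (hc : c ∈ supported (ZMod 2) (ZMod 2) A) : L c ∈ P := by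
  rw [supported_eq_span_single] at hc
  have : Submodule.span (ZMod 2) ((fun l => single l (1 : ZMod 2)) '' A) ≤ P.comap L := by
    rw [Submodule.span_le]
    rintro _ ⟨l, hl, rfl⟩
    exact h l hl
  exact this hc

theorem map_eq_of_mem_supported {M : Type*} [AddCommMonoid M] [Module (ZMod 2) M]
    {A : Set (List α)} {L L' : (List α →₀ ZMod 2) →ₗ[ZMod 2] M}
    (h : ∀ l ∈ A, L (single l 1) = L' (single l 1)) {c : List α →₀ ZMod 2}
    (hc : c ∈ supported (ZMod 2) (ZMod 2) A) : L c = L' c := by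
  rw [supported_eq_span_single] at hc
  exact LinearMap.eqOn_span (s := (fun l => single l (1 : ZMod 2)) '' A)
    (by rintro _ ⟨l, hl, rfl⟩; exact h l hl) hc

theorem single_one_mem_supported {A : Set (List α)} {l : List α} (h : l ∈ A) :
    single l 1 ∈ supported (ZMod 2) (ZMod 2) A :=
  single_mem_supported _ _ h

theorem cone_mem_supported {A B : Set (List α)} {a : α} (h : ∀ l ∈ A, a :: l ∈ B)
    {c : List α →₀ ZMod 2} (hc : c ∈ supported (ZMod 2) (ZMod 2) A) :
    cone a c ∈ supported (ZMod 2) (ZMod 2) B :=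
  map_mem_of_mem_supported
    (fun l hl => by rw [cone_single]; exact single_one_mem_supported (h l hl)) hc

theorem faceSum_mem_supported (l : List α) :
    faceSum l ∈ supported (ZMod 2) (ZMod 2) {l' | l'.length + 1 = l.length ∧ l' ⊆ l} := by
  induction l with
  | nil => exact Submodule.zero_mem _
  | cons a l ih =>
    refine Submodule.add_mem _ (single_one_mem_supported ⟨rfl, List.subset_cons_self a l⟩)
      (cone_mem_supported ?_ ih)
    rintro l' ⟨h1, h2⟩
    exact ⟨by simp [h1], List.cons_subset_cons a h2⟩

/-- The chain map induced by a map of vertices. -/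
noncomputable def map {β : Type*} (f : α → β) :
    (List α →₀ ZMod 2) →ₗ[ZMod 2] (List β →₀ ZMod 2) :=
  lmapDomain (ZMod 2) (ZMod 2) (List.map f)

@[simp] theorem map_single {β : Type*} (f : α → β) (l : List α) (r : ZMod 2) :
    map f (single l r) = single (l.map f) r := by
  simp [map]

theorem map_cone {β : Type*} (f : α → β) (a : α) (c : List α →₀ ZMod 2) :
    map f (cone a c) = cone (f a) (map f c) := by
  suffices map f ∘ₗ cone a = cone (f a) ∘ₗ map f from LinearMap.congr_fun this c
  ext1 l
  ext1
  simp

theorem map_faceSum {β : Type*} (f : α → β) (l : List α) :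
    map f (faceSum l) = faceSum (l.map f) := by
  induction l with
  | nil => simp [faceSum]
  | cons a l ih => simp [faceSum, map_cone, ih]

section Cochain

variable (s : ℕ → α → ZMod 2)

/-- The cup product of the coboundaries of the 0-cochains `s i`. -/
def cup : List α → ZMod 2
  | [] => 1
  | [_] => 1
  | a :: b :: l => (s l.length a + s l.length b) * cup (b :: l)

/-- The cup product of `cup s` with the next 0-cochain. -/
def cupNext : List α → ZMod 2
  | [] => 1
  | a :: l => s l.length a * cup s (a :: l)

theorem cupNext_cons_cons (a b : α) (c : List α →₀ ZMod 2) (m : ℕ)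
    (hc : c ∈ supported (ZMod 2) (ZMod 2) {l | l.length = m}) :
    linearCombination (ZMod 2) (cupNext s) (cone a (cone b c)) =
      s (m + 1) a * linearCombination (ZMod 2) (cup s) (cone a (cone b c)) := by
  refine map_eq_of_mem_supported
    (L := linearCombination (ZMod 2) (cupNext s) ∘ₗ cone a ∘ₗ cone b)
    (L' := s (m + 1) a • linearCombination (ZMod 2) (cup s) ∘ₗ cone a ∘ₗ cone b) ?_ hc
  rintro l rfl
  simp [cupNext]

/-- `cup s` is the coboundary of `cupNext s`, and hence a cocycle. -/
theorem cupNext_faceSum (a b : α) (l : List α) :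
    linearCombination (ZMod 2) (cup s) (faceSum (a :: b :: l)) = 0 ∧
      linearCombination (ZMod 2) (cupNext s) (faceSum (a :: b :: l)) = cup s (a :: b :: l) := by
  induction hm : l.length using Nat.strong_induction_on generalizing a b l with
  | _ m ih =>
    have hcocycle : linearCombination (ZMod 2) (cup s) (faceSum (a :: b :: l)) = 0 := by
      match l, hm with
      | [], _ => simp [faceSum, cup]; decide
      | x :: l, hm =>
        have hsub : ∀ c ∈ supported (ZMod 2) (ZMod 2) {l' : List α | l'.length = l.length + 2},
            linearCombination (ZMod 2) (cup s) c =
              linearCombination (ZMod 2) (cupNext s) (boundary c) := by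
          intro c hc
          refine map_eq_of_mem_supported (L' := linearCombination (ZMod 2) (cupNext s) ∘ₗ boundary)
            ?_ hc
          intro l' hl'
          match l', hl' with
          | a' :: b' :: l', hl' =>
            have := (ih l'.length (by simp at hl' hm; omega) a' b' l' rfl).2
            simp [this]
        rw [hsub, boundary_faceSum, map_zero]
        refine supported_mono ?_ (faceSum_mem_supported _)
        rintro l' ⟨h, -⟩
        simpa using h
    refine ⟨hcocycle, ?_⟩
    match l, hm with
    | [], _ =>
      simp [faceSum, cupNext, cup, add_comm]
    | x :: l, hm =>
      have h1 : linearCombination (ZMod 2) (cupNext s) (cone a (cone b (faceSum (x :: l)))) =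
          s (l.length + 1) a *
            linearCombination (ZMod 2) (cup s) (cone a (cone b (faceSum (x :: l)))) := by
        refine cupNext_cons_cons s a b _ l.length (supported_mono ?_ (faceSum_mem_supported _))
        rintro l' ⟨h, -⟩
        simpa using h
      rw [faceSum, faceSum, map_add] at hcocycle ⊢
      simp only [map_add, cone_single, linearCombination_single, one_smul, h1] at hcocycle ⊢
      generalize linearCombination (ZMod 2) (cup s) (cone a (cone b (faceSum (x :: l)))) = t
        at hcocycle ⊢
      simp only [cupNext, cup, List.length_cons] at hcocycle ⊢
      linear_combination s (l.length + 1) a * hcocycle - s (l.length + 1) a *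
        ((s l.length b + s l.length x) * cup s (x :: l)) * (CharTwo.two_eq_zero : (2 : ZMod 2) = 0)

end Cochain

section Subdivision

variable {E : Type*} [NormedAddCommGroup E] [NormedSpace ℝ E]

/-- The barycenter of an ordered simplex. -/
noncomputable def barycenter (l : List E) : E := (l.length : ℝ)⁻¹ • l.sum

/-- Barycentric subdivision of chains of ordered simplices with `n` vertices. -/
noncomputable def subdiv : ℕ → (List E →₀ ZMod 2) →ₗ[ZMod 2] (List E →₀ ZMod 2)
  | 0 => LinearMap.id
  | n + 1 => linearCombination (ZMod 2) fun l => cone (barycenter l) (subdiv n (faceSum l))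

theorem subdiv_succ_single (n : ℕ) (l : List E) :
    subdiv (n + 1) (single l 1) = cone (barycenter l) (subdiv n (faceSum l)) := by
  simp [subdiv]

theorem faceSum_mem_supported_length {l : List α} {n : ℕ} (hl : l.length = n + 1) :
    faceSum l ∈ supported (ZMod 2) (ZMod 2) {l' | l'.length = n} := by
  refine supported_mono ?_ (faceSum_mem_supported l)
  rintro l' ⟨h, -⟩
  exact Nat.succ_injective (h.trans hl)

theorem boundary_subdiv (n : ℕ) {c : List E →₀ ZMod 2}
    (hc : c ∈ supported (ZMod 2) (ZMod 2) {l | l.length = n + 1}) :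
    boundary (subdiv (n + 1) c) = subdiv n (boundary c) := by
  suffices key : ∀ l ∈ {l : List E | l.length = n + 1},
      (boundary ∘ₗ subdiv (n + 1)) (single l 1) = (subdiv n ∘ₗ boundary) (single l 1) from
    map_eq_of_mem_supported key hc
  clear hc c
  intro l hl
  simp only [LinearMap.comp_apply, boundary_single, subdiv_succ_single, boundary_cone]
  cases n with
  | zero =>
    obtain ⟨a, rfl⟩ := List.length_eq_one_iff.1 hl
    simp [subdiv, faceSum]
  | succ n =>
    rw [boundary_subdiv n (faceSum_mem_supported_length hl), boundary_faceSum, map_zero, map_zero,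
      add_zero]

theorem map_neg_subdiv (n : ℕ) (c : List E →₀ ZMod 2) :
    map (- ·) (subdiv n c) = subdiv n (map (- ·) c) := by
  induction n generalizing c with
  | zero => rfl
  | succ n ih =>
    suffices map (- ·) ∘ₗ subdiv (n + 1) = subdiv (n + 1) ∘ₗ map (- · : E → E) from
      LinearMap.congr_fun this c
    ext1 l
    ext1
    have hbary : barycenter (l.map (- ·)) = -barycenter l := by
      have hsum : (l.map (- ·)).sum = -l.sum := by
        induction l with
        | nil => simp
        | cons a l ih => simp [ih, add_comm]
      rw [barycenter, barycenter, hsum, List.length_map, smul_neg]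
    simp only [LinearMap.comp_apply, lsingle_apply, map_single, subdiv_succ_single, map_cone, ih,
      map_faceSum, hbary]

theorem norm_sum_sub_le {l : List E} {v : E} {r : ℝ} (h : ∀ u ∈ l, dist u v ≤ r) :
    ‖l.sum - (l.length : ℝ) • v‖ ≤ l.length * r := by
  induction l with
  | nil => simp
  | cons a l ih =>
    have h1 := ih fun u hu => h u (List.mem_cons_of_mem _ hu)
    have h2 : ‖a - v‖ ≤ r := by simpa [dist_eq_norm] using h a List.mem_cons_self
    have h3 : (a :: l).sum - ((a :: l).length : ℝ) • v =
        (a - v) + (l.sum - (l.length : ℝ) • v) := by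
      simp only [List.sum_cons, List.length_cons]
      push_cast
      module
    rw [h3]
    refine (norm_add_le _ _).trans ?_
    simp only [List.length_cons]
    push_cast
    linarith

theorem dist_barycenter_le {l : List E} {v : E} {r : ℝ} (hv : v ∈ l)
    (h : ∀ u ∈ l, dist u v ≤ r) : dist v (barycenter l) ≤ (1 - (l.length : ℝ)⁻¹) * r := by
  obtain ⟨s, t, rfl⟩ := List.append_of_mem hv
  have h1 := norm_sum_sub_le (l := s ++ t) (v := v) (r := r)
    fun u hu => h u (by simp at hu ⊢; tauto)
  have hpos : 0 < ((s ++ v :: t).length : ℝ) := by simp; positivity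
  have hlen : ((s ++ v :: t).length : ℝ) = (s ++ t).length + 1 := by simp; ring
  have hsum : (s ++ v :: t).sum = (s ++ t).sum + v := by simp; abel
  have h2 : barycenter (s ++ v :: t) - v =
      ((s ++ v :: t).length : ℝ)⁻¹ • ((s ++ t).sum - ((s ++ t).length : ℝ) • v) := by
    rw [barycenter, hsum, eq_inv_smul_iff₀ hpos.ne', smul_sub, smul_inv_smul₀ hpos.ne', hlen]
    module
  rw [dist_comm, dist_eq_norm, h2, norm_smul, norm_inv, Real.norm_of_nonneg hpos.le]
  calc _ ≤ ((s ++ v :: t).length : ℝ)⁻¹ * ((s ++ t).length * r) := by gcongr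
    _ = _ := by
      rw [hlen] at hpos ⊢
      field_simp
      ring

theorem barycenter_mem_convexHull {l : List E} (hl : l ≠ []) :
    barycenter l ∈ convexHull ℝ {x | x ∈ l} := by
  have hpos : (0 : ℝ) < l.length := by
    exact_mod_cast List.length_pos_iff.2 hl
  have : barycenter l = ∑ i : Fin l.length, (l.length : ℝ)⁻¹ • l[i] := by
    rw [← Finset.smul_sum, barycenter]
    exact congrArg _ (Fin.sum_univ_getElem l).symm
  rw [this]
  refine (convex_convexHull ℝ _).sum_mem (fun _ _ => by positivity) ?_ fun i _ =>
    subset_convexHull ℝ _ (List.getElem_mem _)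
  simp [hpos.ne']

/-- Ordered simplices with `n` vertices at mutual distance at most `r`, with convex hull in `S`. -/
def smallSimplices (S : Set E) (n : ℕ) (r : ℝ) : Set (List E) :=
  {l | l.length = n ∧ convexHull ℝ {x | x ∈ l} ⊆ S ∧ ∀ x ∈ l, ∀ y ∈ l, dist x y ≤ r}

theorem faceSum_mem_supported_smallSimplices {S : Set E} {n : ℕ} {r : ℝ} {l : List E}
    (hl : l ∈ smallSimplices S (n + 1) r) :
    faceSum l ∈ supported (ZMod 2) (ZMod 2) (smallSimplices S n r) := by
  refine supported_mono ?_ (faceSum_mem_supported l)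
  rintro l' ⟨h1, h2⟩
  refine ⟨by have := hl.1; omega, (convexHull_mono fun x hx => h2 hx).trans hl.2.1, ?_⟩
  exact fun x hx y hy => hl.2.2 x (h2 hx) y (h2 hy)

theorem subdiv_mem_supported {S : Set E} {n N : ℕ} {r : ℝ} (hr : 0 ≤ r) (hn : n ≤ N)
    {c : List E →₀ ZMod 2} (hc : c ∈ supported (ZMod 2) (ZMod 2) (smallSimplices S n r)) :
    subdiv n c ∈ supported (ZMod 2) (ZMod 2) (smallSimplices S n ((1 - (N : ℝ)⁻¹) * r)) := by
  induction n generalizing S c with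
  | zero =>
    refine supported_mono ?_ hc
    rintro l ⟨h1, h2, -⟩
    obtain rfl := List.length_eq_zero_iff.1 h1
    exact ⟨h1, h2, by simp⟩
  | succ n ih =>
    refine map_mem_of_mem_supported ?_ hc
    rintro l hl
    rw [subdiv_succ_single]
    have hface := ih (by omega) (faceSum_mem_supported_smallSimplices
      (⟨hl.1, subset_rfl, hl.2.2⟩ : l ∈ smallSimplices (convexHull ℝ {x | x ∈ l}) (n + 1) r))
    have hne : l ≠ [] := by rintro rfl; simpa using hl.1
    refine cone_mem_supported ?_ hface
    rintro l' ⟨h1, h2, h3⟩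
    have hcN : (l.length : ℝ) ≤ N := by rw [hl.1]; exact_mod_cast hn
    have hball : convexHull ℝ {x | x ∈ l} ⊆
        Metric.closedBall (barycenter l) ((1 - (N : ℝ)⁻¹) * r) := by
      refine convexHull_min (fun v hv => ?_) (convex_closedBall _ _)
      refine (dist_barycenter_le hv fun u hu => hl.2.2 u hu v hv).trans ?_
      have : (0 : ℝ) < l.length := by exact_mod_cast List.length_pos_iff.2 hne
      gcongr
    have hmem : ∀ x ∈ l', x ∈ convexHull ℝ {x | x ∈ l} := fun x hx =>
      h2 (subset_convexHull ℝ _ hx)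
    have hb := barycenter_mem_convexHull hne
    refine ⟨by simp [h1], ?_, ?_⟩
    · refine (convexHull_min ?_ (convex_convexHull ℝ _)).trans hl.2.1
      intro x hx
      rcases List.mem_cons.1 hx with rfl | hx
      exacts [hb, hmem x hx]
    · intro x hx y hy
      rcases List.mem_cons.1 hx with rfl | hx <;> rcases List.mem_cons.1 hy with rfl | hy
      · exact hball hb
      · rw [dist_comm]
        exact hball (hmem y hy)
      · exact hball (hmem x hx)
      · exact h3 x hx y hy

theorem subdiv_mem_supported_length {n : ℕ} {c : List E →₀ ZMod 2}
    (hc : c ∈ supported (ZMod 2) (ZMod 2) {l | l.length = n}) :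
    subdiv n c ∈ supported (ZMod 2) (ZMod 2) {l | l.length = n} := by
  induction n generalizing c with
  | zero => exact hc
  | succ n ih =>
    refine map_mem_of_mem_supported (fun l hl => ?_) hc
    rw [subdiv_succ_single]
    refine cone_mem_supported ?_ (ih (faceSum_mem_supported_length hl))
    intro l' hl'
    simpa using hl'

end Subdivision

section CrossPolytope

variable {E : Type*} [AddCommGroup E] (e : ℕ → E)

/-- The fundamental cycle of the boundary of the cross-polytope with vertices `±e i`, `i < k`. -/
noncomputable def crossPolytope : ℕ → (List E →₀ ZMod 2)
  | 0 => single [] 1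
  | k + 1 => cone (e k) (crossPolytope k) + cone (-e k) (crossPolytope k)

theorem map_neg_crossPolytope (k : ℕ) :
    map (- ·) (crossPolytope e k) = crossPolytope e k := by
  induction k with
  | zero => simp [crossPolytope]
  | succ k ih => simp [crossPolytope, map_cone, ih, add_comm]

theorem boundary_crossPolytope (k : ℕ) : boundary (crossPolytope e k) = 0 := by
  induction k with
  | zero => simp [crossPolytope, faceSum]
  | succ k ih => simp [crossPolytope, boundary_cone, ih, add_self_eq_zero]

theorem crossPolytope_mem_supported_length (k : ℕ) :
    crossPolytope e k ∈ supported (ZMod 2) (ZMod 2) {l | l.length = k} := by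
  induction k with
  | zero => exact single_one_mem_supported rfl
  | succ k ih =>
    exact Submodule.add_mem _ (cone_mem_supported (by simp) ih) (cone_mem_supported (by simp) ih)

theorem cup_map_neg {s : ℕ → E → ZMod 2} (hs : ∀ i, ∀ x ≠ 0, s i (-x) = s i x + 1) (l : List E)
    (hl : ∀ x ∈ l, x ≠ 0) : cup s (l.map (- ·)) = cup s l := by
  induction l with
  | nil => rfl
  | cons a l ih =>
    match l, ih with
    | [], _ => rfl
    | b :: l, ih =>
      have ih := ih fun x hx => hl x (List.mem_cons_of_mem _ hx)
      simp only [List.map_cons] at ih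
      simp only [List.map_cons, cup, List.length_map, ih, hs _ a (hl a (by simp)),
        hs _ b (hl b (by simp))]
      congr 1
      linear_combination (CharTwo.two_eq_zero : (2 : ZMod 2) = 0)

end CrossPolytope

section Hemisphere

variable {E : Type*} [NormedAddCommGroup E] [NormedSpace ℝ E] (e : ℕ → E)

/-- The upper half of `crossPolytope e (k + 1)`, subdivided `N` times. -/
noncomputable def hemisphere (N k : ℕ) : List E →₀ ZMod 2 :=
  (subdiv (k + 1))^[N] (cone (e k) (crossPolytope e k))

theorem hemisphere_mem_supported_length (N k : ℕ) :
    hemisphere e N k ∈ supported (ZMod 2) (ZMod 2) {l | l.length = k + 1} := by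
  induction N with
  | zero => exact cone_mem_supported (by simp) (crossPolytope_mem_supported_length e k)
  | succ N ih =>
    rw [hemisphere, Function.iterate_succ_apply']
    exact subdiv_mem_supported_length ih

theorem boundary_hemisphere (N k : ℕ) :
    boundary (hemisphere e N k) = (subdiv k)^[N] (crossPolytope e k) := by
  induction N with
  | zero => simp [hemisphere, boundary_cone, boundary_crossPolytope]
  | succ N ih =>
    have := hemisphere_mem_supported_length e N k
    rw [hemisphere] at this ih ⊢
    rw [Function.iterate_succ_apply', Function.iterate_succ_apply', boundary_subdiv k this, ih]

theorem boundary_hemisphere_succ (N k : ℕ) :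
    boundary (hemisphere e N (k + 1)) = hemisphere e N k + map (- ·) (hemisphere e N k) := by
  rw [boundary_hemisphere]
  induction N with
  | zero => simp [hemisphere, crossPolytope, map_cone, map_neg_crossPolytope]
  | succ N ih =>
    rw [Function.iterate_succ_apply', ih, map_add, ← map_neg_subdiv, hemisphere, hemisphere,
      Function.iterate_succ_apply']

theorem boundary_hemisphere_zero (N : ℕ) : boundary (hemisphere e N 0) = single [] 1 := by
  rw [boundary_hemisphere]
  induction N with
  | zero => rfl
  | succ N ih => rw [Function.iterate_succ_apply', ih]; rfl

theorem hemisphere_mem_supported {S : Set E} {r : ℝ} (hr : 0 ≤ r) (N k : ℕ)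
    (h : cone (e k) (crossPolytope e k) ∈
      supported (ZMod 2) (ZMod 2) (smallSimplices S (k + 1) r)) :
    hemisphere e N k ∈ supported (ZMod 2) (ZMod 2)
      (smallSimplices S (k + 1) ((1 - ((k + 1 : ℕ) : ℝ)⁻¹) ^ N * r)) := by
  induction N with
  | zero => simpa [hemisphere] using h
  | succ N ih =>
    have hk : (0 : ℝ) ≤ 1 - ((k + 1 : ℕ) : ℝ)⁻¹ := by
      rw [sub_nonneg]
      exact inv_le_one_of_one_le₀ (by simp)
    rw [hemisphere, Function.iterate_succ_apply', pow_succ', mul_assoc]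
    exact subdiv_mem_supported (by positivity) le_rfl ih

theorem cup_hemisphere {s : ℕ → E → ZMod 2} (hs : ∀ i, ∀ x ≠ 0, s i (-x) = s i x + 1) (N k : ℕ)
    (h : ∀ j ≤ k, hemisphere e N j ∈
      supported (ZMod 2) (ZMod 2) {l | l.length = j + 1 ∧ ∀ x ∈ l, x ≠ 0}) :
    linearCombination (ZMod 2) (cup s) (hemisphere e N k) = 1 := by
  induction k with
  | zero =>
    have key : linearCombination (ZMod 2) (cup s) (hemisphere e N 0) =
        linearCombination (ZMod 2) (fun _ => 1) (boundary (hemisphere e N 0)) := by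
      refine map_eq_of_mem_supported
        (L' := linearCombination (ZMod 2) (fun _ => 1) ∘ₗ boundary) ?_ (h 0 le_rfl)
      rintro l ⟨hl, -⟩
      obtain ⟨a, rfl⟩ := List.length_eq_one_iff.1 hl
      simp [cup, faceSum]
    rw [key, boundary_hemisphere_zero]
    simp
  | succ k ih =>
    rw [← ih fun j hj => h j (by omega)]
    have key : linearCombination (ZMod 2) (cup s) (hemisphere e N (k + 1)) =
        linearCombination (ZMod 2) (cupNext s) (boundary (hemisphere e N (k + 1))) := by
      refine map_eq_of_mem_supported
        (L' := linearCombination (ZMod 2) (cupNext s) ∘ₗ boundary) ?_ (h (k + 1) le_rfl)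
      rintro l ⟨hl, -⟩
      match l, hl with
      | a :: b :: l, _ => simp [(cupNext_faceSum s a b l).2]
    rw [key, boundary_hemisphere_succ, map_add]
    refine map_eq_of_mem_supported
      (L := linearCombination (ZMod 2) (cupNext s) +
        linearCombination (ZMod 2) (cupNext s) ∘ₗ map (- ·)) ?_ (h k (by omega))
    rintro l ⟨hl, hl0⟩
    match l, hl with
    | a :: l, _ =>
      have := cup_map_neg hs (a :: l) hl0
      simp only [List.map_cons] at this
      simp only [LinearMap.add_apply, LinearMap.comp_apply, map_single, List.map_cons,
        linearCombination_single, one_smul, cupNext, List.length_map, this,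
        hs _ a (hl0 a (by simp))]
      linear_combination s l.length a * cup s (a :: l) * (CharTwo.two_eq_zero : (2 : ZMod 2) = 0)

end Hemisphere

theorem cup_eq_zero {s : ℕ → α → ZMod 2} {l : List α} {i : ℕ} (hi : i + 2 ≤ l.length)
    (h : ∀ x ∈ l, ∀ y ∈ l, s i x = s i y) : cup s l = 0 := by
  induction l with
  | nil => simp at hi
  | cons a l ih =>
    match l, ih, hi with
    | [], _, hi => simp at hi
    | b :: l, ih, hi =>
      rw [cup]
      rcases eq_or_ne i l.length with rfl | hne
      · rw [h a (by simp) b (by simp), CharTwo.add_self_eq_zero, zero_mul]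
      · rw [ih (by simp at hi ⊢; omega) fun x hx y hy =>
          h x (List.mem_cons_of_mem _ hx) y (List.mem_cons_of_mem _ hy), mul_zero]

/-- The ordered simplices with `k` vertices, each of the form `±e i` with `i < k`, where the sign
depends on `i` only. -/
def signedSimplices {E : Type*} [AddCommGroup E] (e : ℕ → E) (k : ℕ) : Set (List E) :=
  {l | l.length = k ∧ ∃ v : ℕ → E, (∀ i, v i = e i ∨ v i = -e i) ∧ ∀ x ∈ l, ∃ i < k, x = v i}

theorem cons_mem_signedSimplices {E : Type*} [AddCommGroup E] {e : ℕ → E} {k : ℕ} {u : E}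
    (hu : u = e k ∨ u = -e k) {l : List E} (hl : l ∈ signedSimplices e k) :
    u :: l ∈ signedSimplices e (k + 1) := by
  obtain ⟨hl, v, hv, hlv⟩ := hl
  refine ⟨by simp [hl], Function.update v k u, fun i => ?_, fun x hx => ?_⟩
  · rcases eq_or_ne i k with rfl | hik
    · simpa using hu
    · simpa [hik] using hv i
  · rcases List.mem_cons.1 hx with rfl | hx
    · exact ⟨k, by simp, by simp⟩
    · obtain ⟨i, hi, rfl⟩ := hlv x hx
      exact ⟨i, by omega, by simp [hi.ne]⟩

theorem crossPolytope_mem_supported {E : Type*} [AddCommGroup E] (e : ℕ → E) (k : ℕ) :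
    crossPolytope e k ∈ supported (ZMod 2) (ZMod 2) (signedSimplices e k) := by
  induction k with
  | zero => exact single_one_mem_supported ⟨rfl, e, by simp⟩
  | succ k ih =>
    exact Submodule.add_mem _
      (cone_mem_supported (fun _ => cons_mem_signedSimplices (Or.inl rfl)) ih)
      (cone_mem_supported (fun _ => cons_mem_signedSimplices (Or.inr rfl)) ih)

/-- The standard basis of `ℝ^(n+1)`, extended by zero. -/
def stdVertex (n : ℕ) (i : ℕ) (j : Fin (n + 1)) : ℝ := if (j : ℕ) = i then 1 else 0

theorem convexHull_subset_crossPolytope {n : ℕ} {l : List (Fin (n + 1) → ℝ)}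
    {v : ℕ → Fin (n + 1) → ℝ}
    (hv : ∀ i, v i = stdVertex n i ∨ v i = -stdVertex n i)
    (hl : ∀ x ∈ l, ∃ i < n + 1, x = v i) :
    convexHull ℝ {x | x ∈ l} ⊆ {x | ∑ i, |x i| = 1} := by
  let F : Set (Fin (n + 1) → ℝ) :=
    {x | (∀ j : Fin (n + 1), 0 ≤ v j j * x j) ∧ ∑ j : Fin (n + 1), v j j * x j = 1}
  have hF : Convex ℝ F := by
    rintro x ⟨hx, hx'⟩ y ⟨hy, hy'⟩ a b ha hb hab
    have heq (j : Fin (n + 1)) :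
        v j j * (a • x + b • y) j = a * (v j j * x j) + b * (v j j * y j) := by
      simp only [Pi.add_apply, Pi.smul_apply, smul_eq_mul]
      ring
    refine ⟨fun j => ?_, ?_⟩
    · rw [heq]
      exact add_nonneg (mul_nonneg ha (hx j)) (mul_nonneg hb (hy j))
    · simp only [heq, Finset.sum_add_distrib, ← Finset.mul_sum, hx', hy', mul_one, hab]
  have hsign (j : Fin (n + 1)) : v j j = 1 ∨ v j j = -1 := by
    rcases hv j with h | h <;> simp [h, stdVertex]
  have hlF : {x | x ∈ l} ⊆ F := by
    intro x hx
    obtain ⟨i, hi, rfl⟩ := hl x hx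
    have heq (j : Fin (n + 1)) : v j j * v i j = if j = ⟨i, hi⟩ then 1 else 0 := by
      by_cases hj : j = ⟨i, hi⟩
      · subst hj
        rcases hsign ⟨i, hi⟩ with h | h <;> simp only at h <;> simp [h]
      · have : (j : ℕ) ≠ i := fun h => hj (Fin.ext h)
        rcases hv i with h | h <;> simp [h, stdVertex, this, hj]
    exact ⟨fun j => by rw [heq]; split_ifs <;> simp, by simp [heq]⟩
  refine (convexHull_min hlF hF).trans ?_
  rintro x ⟨hx, hx'⟩
  rw [← hx']
  refine Finset.sum_congr rfl fun j _ => ?_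
  have := hx j
  rcases hsign j with h | h <;> rw [h] at this ⊢
  · rw [one_mul] at this ⊢
    exact abs_of_nonneg this
  · rw [neg_one_mul] at this ⊢
    exact abs_of_nonpos (by linarith)

theorem abs_le_one_of_sum_abs {ι : Type*} [Fintype ι] {x : ι → ℝ} (hx : ∑ i, |x i| = 1) (i : ι) :
    |x i| ≤ 1 :=
  hx ▸ Finset.single_le_sum (f := fun i => |x i|) (fun _ _ => abs_nonneg _) (Finset.mem_univ i)

theorem hemisphere_stdVertex_mem_supported {n k : ℕ} (hk : k ≤ n) (N : ℕ) :
    hemisphere (stdVertex n) N k ∈ supported (ZMod 2) (ZMod 2)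
      (smallSimplices {x | ∑ i, |x i| = 1} (k + 1) ((1 - ((k + 1 : ℕ) : ℝ)⁻¹) ^ N * 2)) := by
  refine hemisphere_mem_supported _ zero_le_two N k (cone_mem_supported (fun l hl => ?_)
    (crossPolytope_mem_supported _ k))
  obtain ⟨h1, v, hv, hlv⟩ := cons_mem_signedSimplices (Or.inl rfl) hl
  have hS := convexHull_subset_crossPolytope hv fun x hx => by
    obtain ⟨i, hi, rfl⟩ := hlv x hx
    exact ⟨i, by omega, rfl⟩
  refine ⟨h1, hS, fun x hx y hy => ?_⟩
  rw [dist_pi_le_iff zero_le_two]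
  intro i
  have hx := abs_le_one_of_sum_abs (hS (subset_convexHull ℝ _ hx)) i
  have hy := abs_le_one_of_sum_abs (hS (subset_convexHull ℝ _ hy)) i
  rw [Real.dist_eq]
  exact (abs_sub _ _).trans (by linarith)

theorem exists_sign (n : ℕ) :
    ∃ σ : (Fin n → ℝ) → ZMod 2, ∀ x ≠ 0, σ (-x) = σ x + 1 := by
  classical
  refine ⟨fun x => if 0 < toLex x then 1 else 0, fun x hx => ?_⟩
  have h1 : toLex x ≠ 0 := hx
  rcases h1.lt_or_gt with h1 | h1
  · have h2 : 0 < toLex (-x) := neg_pos.2 h1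
    have h3 : ¬0 < toLex x := h1.not_gt
    simp only [if_pos h2, if_neg h3, zero_add]
  · have h2 : toLex (-x) < 0 := neg_neg_iff_pos.2 h1
    have h3 : ¬0 < toLex (-x) := h2.not_gt
    have h4 : 0 < toLex x := h1
    simp only [if_neg h3, if_pos h4]
    exact (CharTwo.add_self_eq_zero _).symm

/-- The **Borsuk–Ulam theorem** on the boundary of the cross-polytope. -/
theorem borsuk_ulam {n : ℕ} {h : Fin n → (Fin (n + 1) → ℝ) → ℝ} (hc : ∀ i, Continuous (h i))
    (hodd : ∀ i x, h i (-x) = -h i x) : ∃ x, ∑ i, |x i| = 1 ∧ ∀ i, h i x = 0 := by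
  by_contra! hne
  have hcompact : IsCompact {x : Fin (n + 1) → ℝ | ∑ i, |x i| = 1} := by
    refine Metric.isCompact_of_isClosed_isBounded
      (isClosed_eq (by fun_prop) continuous_const) ?_
    refine (Metric.isBounded_closedBall (x := 0) (r := 1)).subset fun x hx => ?_
    rw [mem_closedBall_zero_iff, pi_norm_le_iff_of_nonneg zero_le_one]
    exact abs_le_one_of_sum_abs hx
  obtain ⟨δ, hδ, hball⟩ := lebesgue_number_lemma_of_metric
    (c := Sum.elim (fun i => {x | 0 < h i x}) (fun i => {x | h i x < 0})) hcompact
    (by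
      rintro (i | i)
      exacts [isOpen_lt continuous_const (hc i), isOpen_lt (hc i) continuous_const])
    (by
      intro x hx
      obtain ⟨i, hi⟩ := hne x hx
      rw [Set.mem_iUnion]
      rcases hi.lt_or_gt with hi | hi
      exacts [⟨Sum.inr i, hi⟩, ⟨Sum.inl i, hi⟩])
  obtain ⟨N, hN⟩ : ∃ N : ℕ, (1 - ((n + 1 : ℕ) : ℝ)⁻¹) ^ N * 2 < δ := by
    obtain ⟨N, hN⟩ := exists_pow_lt_of_lt_one (half_pos hδ)
      (sub_lt_self 1 (by positivity : (0 : ℝ) < ((n + 1 : ℕ) : ℝ)⁻¹))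
    exact ⟨N, by linarith⟩
  obtain ⟨σ, hσ⟩ := exists_sign (n + 1)
  let s : ℕ → (Fin (n + 1) → ℝ) → ZMod 2 := fun i x =>
    if hi : i < n then
      if 0 < h ⟨i, hi⟩ x then 1 else if h ⟨i, hi⟩ x < 0 then 0 else σ x
    else σ x
  have hs (i x) (hx : x ≠ 0) : s i (-x) = s i x + 1 := by
    by_cases hi : i < n
    · simp only [s, hi, dif_pos, hodd, Left.neg_pos_iff, Left.neg_neg_iff]
      rcases lt_trichotomy (h ⟨i, hi⟩ x) 0 with h1 | h1 | h1
      · simp [h1, h1.not_gt]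
      · simp [h1, hσ x hx]
      · simp only [h1, h1.not_gt, if_true, if_false]
        decide
    · simp [s, hi, hσ x hx]
  have hone := cup_hemisphere hs N n (e := stdVertex n) (by
    intro j hj
    refine supported_mono ?_ (hemisphere_stdVertex_mem_supported hj N)
    rintro l ⟨h1, h2, -⟩
    refine ⟨h1, ?_⟩
    rintro x hx rfl
    simpa using h2 (subset_convexHull ℝ _ hx))
  have hzero := map_eq_of_mem_supported (L := linearCombination (ZMod 2) (cup s)) (L' := 0) (by
    rintro l ⟨h1, h2, h3⟩
    rw [linearCombination_single, one_smul, LinearMap.zero_apply]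
    have hS : ∀ x ∈ l, ∑ i, |x i| = 1 := fun x hx => h2 (subset_convexHull ℝ _ hx)
    obtain ⟨a, ha⟩ := List.exists_mem_of_length_pos (l := l) (by omega)
    obtain ⟨i, hi⟩ := hball a (hS a ha)
    have hmem : ∀ x ∈ l, x ∈ Metric.ball a δ := fun x hx => (h3 x hx a ha).trans_lt hN
    rcases i with i | i
    · refine cup_eq_zero (i := i) (by omega) fun x hx y hy => ?_
      have hx : 0 < h i x := hi (hmem x hx)
      have hy : 0 < h i y := hi (hmem y hy)
      simp [s, hx, hy]
    · refine cup_eq_zero (i := i) (by omega) fun x hx y hy => ?_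
      have hx : h i x < 0 := hi (hmem x hx)
      have hy : h i y < 0 := hi (hmem y hy)
      simp [s, hx, hy, hx.not_gt, hy.not_gt]) (hemisphere_stdVertex_mem_supported le_rfl N)
  exact one_ne_zero (hone.symm.trans hzero)

end ListChain

open Finset in
/-- The sum of all squarefree monomials of degree `k + 1` in nonnegative reals vanishes iff at most
`k` of them are nonzero. -/
theorem sum_powersetCard_prod_eq_zero_iff {ι : Type*} [Fintype ι] {u : ι → ℝ}
    (hu : ∀ i, 0 ≤ u i) (k : ℕ) :
    ∑ S ∈ powersetCard (k + 1) univ, ∏ i ∈ S, u i = 0 ↔ #{i | u i ≠ 0} ≤ k := by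
  rw [sum_eq_zero_iff_of_nonneg fun S _ => prod_nonneg fun i _ => hu i]
  constructor
  · intro h
    by_contra! hk
    obtain ⟨S, hS, hcard⟩ := exists_subset_card_eq (Nat.succ_le_of_lt hk)
    obtain ⟨i, hi, hi0⟩ := prod_eq_zero_iff.1 (h S (mem_powersetCard.2 ⟨subset_univ _, hcard⟩))
    exact (mem_filter.1 (hS hi)).2 hi0
  · intro h S hS
    rw [prod_eq_zero_iff]
    by_contra! hne
    have := card_le_card (t := ({i | u i ≠ 0} : Finset ι)) fun i hi => by simpa using hne i hi
    have := (mem_powersetCard.1 hS).2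
    omega

open Finset in
/-- Any continuous map from nonnegative weights on `2d+1` vertices to `ℝ^(2d−2)` identifies two
points of the geometric realization of the `(d−1)`-skeleton with disjoint supports. -/
theorem exists_eq_of_disjoint_support {d : ℕ} (hd : 1 ≤ d)
    {F : Fin (2 * d - 2) → (Fin (2 * d + 1) → ℝ) → ℝ} (hF : ∀ i, Continuous (F i)) :
    ∃ u v : Fin (2 * d + 1) → ℝ, ((∀ i, 0 ≤ u i) ∧ ∑ i, u i = 1 ∧ #{i | u i ≠ 0} ≤ d) ∧
      ((∀ i, 0 ≤ v i) ∧ ∑ i, v i = 1 ∧ #{i | v i ≠ 0} ≤ d) ∧ (∀ i, u i = 0 ∨ v i = 0) ∧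
      ∀ i, F i u = F i v := by
  let G : Fin (2 * d) → (Fin (2 * d + 1) → ℝ) → ℝ := fun i u =>
    if hi : (i : ℕ) < 2 * d - 2 then F ⟨i, hi⟩ u
    else if (i : ℕ) = 2 * d - 2 then ∑ j, u j
    else ∑ S ∈ powersetCard (d + 1) univ, ∏ j ∈ S, u j
  have hG (i) : Continuous (G i) := by
    by_cases hi : (i : ℕ) < 2 * d - 2
    · simpa only [G, hi, dif_pos] using hF _
    · by_cases hi' : (i : ℕ) = 2 * d - 2
      · simp only [G, hi', lt_irrefl, dif_neg, not_false_eq_true, if_true]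
        fun_prop
      · simp only [G, hi, hi', dif_neg, not_false_eq_true, if_false]
        fun_prop
  let P : (Fin (2 * d + 1) → ℝ) → Fin (2 * d + 1) → ℝ := fun x i => 2 * max (x i) 0
  have hP : Continuous P := by fun_prop
  obtain ⟨x, hx, hGx⟩ := ListChain.borsuk_ulam (h := fun i x => G i (P x) - G i (P (-x)))
    (fun i => ((hG i).comp hP).sub ((hG i).comp (hP.comp continuous_neg)))
    (fun i x => by simp)
  have hGx i : G i (P x) = G i (P (-x)) := sub_eq_zero.1 (hGx i)
  have hnonneg (y) (i) : 0 ≤ P y i := by positivity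
  have hdisj (i) : P x i = 0 ∨ P (-x) i = 0 := by
    rcases le_total (x i) 0 with h | h
    · simp [P, h]
    · simp [P, h]
  have hsum : ∑ i, P x i = ∑ i, P (-x) i := by
    simpa [G] using hGx ⟨2 * d - 2, by omega⟩
  have hsum' : ∑ i, P x i + ∑ i, P (-x) i = 2 := by
    have hx2 : ∑ i, 2 * |x i| = 2 := by rw [← mul_sum, hx, mul_one]
    rw [← sum_add_distrib, ← hx2]
    refine sum_congr rfl fun i _ => ?_
    rcases le_total (x i) 0 with h | h
    · simp [P, h, abs_of_nonpos]
    · simp [P, h, abs_of_nonneg]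
  have hcard : #{i | P x i ≠ 0} ≤ d ↔ #{i | P (-x) i ≠ 0} ≤ d := by
    have h := hGx ⟨2 * d - 1, by omega⟩
    simp only [G, show ¬ 2 * d - 1 < 2 * d - 2 by omega, show 2 * d - 1 ≠ 2 * d - 2 by omega,
      dif_neg, not_false_eq_true, if_false] at h
    rw [← sum_powersetCard_prod_eq_zero_iff (hnonneg x),
      ← sum_powersetCard_prod_eq_zero_iff (hnonneg (-x)), h]
  have hcard' : #{i | P x i ≠ 0} + #{i | P (-x) i ≠ 0} ≤ 2 * d + 1 := by
    rw [← card_union_of_disjoint]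
    · exact (card_le_univ _).trans_eq (Fintype.card_fin _)
    · refine disjoint_filter.2 fun i _ h1 h2 => ?_
      exact (hdisj i).elim h1 h2
  refine ⟨P x, P (-x), ⟨hnonneg x, by linarith, ?_⟩, ⟨hnonneg (-x), by linarith, ?_⟩, hdisj,
    fun i => ?_⟩
  · by_contra h
    exact h (hcard.2 (by omega))
  · by_contra h
    exact h (hcard.1 (by omega))
  · simpa [G] using hGx ⟨i, by omega⟩

theorem isClosed_realization {V : Type} [DecidableEq V] [Fintype V] (C : SimplicialCx V) :
    IsClosed (realization C) := by
  have : realization C = ⋃ σ ∈ C.faces,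
      {w | (∀ v, 0 ≤ w v) ∧ (∀ v, v ∉ σ → w v = 0) ∧ ∑ v ∈ σ, w v = 1} := by
    ext w
    simp only [realization, Set.mem_iUnion, Set.mem_ofPred_eq, exists_prop]
  rw [this]
  refine Set.Finite.isClosed_biUnion C.faces.finite_toSet fun σ _ => ?_
  simp only [Set.ofPred_and, Set.ofPred_forall]
  refine IsClosed.inter ?_ (IsClosed.inter ?_ ?_)
  · exact isClosed_iInter fun v => isClosed_le continuous_const (continuous_apply v)
  · exact isClosed_iInter fun v => isClosed_iInter fun _ =>
      isClosed_eq (continuous_apply v) continuous_const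
  · exact isClosed_eq (by fun_prop) continuous_const

/-- Van Kampen–Flores: the `(d−1)`-skeleton of the `2d`-simplex (all nonempty
subsets of its `2d+1` vertices of cardinality at most `d`) does not
topologically embed in `ℝ^(2d−2)`. -/
theorem van_kampen_flores (d : ℕ) (hd : 1 ≤ d)
    (C : SimplicialCx (Fin (2 * d + 1)))
    (hC : ∀ σ : Finset (Fin (2 * d + 1)),
      σ ∈ C.faces ↔ (σ.Nonempty ∧ σ.card ≤ d)) :
    ¬ TopologicallyEmbeds C (2 * d - 2) := by
  rintro ⟨f, hf⟩
  have hext (i : Fin (2 * d - 2)) : ∃ g : C(Fin (2 * d + 1) → ℝ, ℝ),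
      ∀ w : realization C, g w = f w i := by
    obtain ⟨g, hg⟩ := ContinuousMap.exists_restrict_eq (isClosed_realization C)
      (⟨fun w => f w i, by have := hf.continuous; fun_prop⟩ : C(realization C, ℝ))
    exact ⟨g, fun w => DFunLike.congr_fun hg w⟩
  choose F hF using hext
  have hmem {w : Fin (2 * d + 1) → ℝ} (hw : (∀ i, 0 ≤ w i) ∧ ∑ i, w i = 1 ∧
      Finset.card {i | w i ≠ 0} ≤ d) : w ∈ realization C := by
    obtain ⟨h0, h1, h2⟩ := hw
    have hsum : ∑ i with w i ≠ 0, w i = 1 := by rw [Finset.sum_filter_ne_zero, h1]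
    refine ⟨({i | w i ≠ 0} : Finset _), (hC _).2 ⟨?_, h2⟩, h0, by simp, hsum⟩
    by_contra hempty
    rw [Finset.not_nonempty_iff_eq_empty.1 hempty] at hsum
    simp at hsum
  obtain ⟨u, v, hu, hv, hdisj, huv⟩ :=
    exists_eq_of_disjoint_support hd fun i => (F i).continuous
  have hfuv : f ⟨u, hmem hu⟩ = f ⟨v, hmem hv⟩ := by
    ext i
    rw [← hF, ← hF]
    exact huv i
  obtain rfl : u = v := congrArg Subtype.val (hf.injective hfuv)
  have hzero : ∀ i, u i = 0 := fun i => or_self_iff.1 (hdisj i)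
  simpa [hzero] using hu.2.1
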